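/- Let t > 0 and k > 0 be real numbers and a ∈ ℝ with a ≠ 1 and |a| < e^{kt}. Then the function p ↦ ((a^{⌊p/k⌋} − 1)/(a − 1))·e^{−tp} is integrable on [0,∞) and ∫₀^∞ ((a^{⌊p/k⌋} − 1)/(a − 1))·e^{−tp} dp = 1/(t(e^{kt} − a)), where ⌊p/k⌋ denotes the integer part of p/k (a natural number for p ≥ 0). -/

import Mathlib

open MeasureTheory

lemma floor_div_eq_of_mem_Ico {k p : ℝ} (hk : 0 < k) {n : ℕ}
    (hp : p ∈ Set.Ico (n * k) ((n + 1) * k)) : ⌊p / k⌋₊ = n := by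
  have h0 : 0 ≤ p := le_trans (by positivity) hp.1
  rw [Nat.floor_eq_iff (by positivity), le_div_iff₀ hk, div_lt_iff₀ hk]
  exact hp

lemma iUnion_Ico_natCast_mul {k : ℝ} (hk : 0 < k) :
    ⋃ n : ℕ, Set.Ico (n * k) ((n + 1) * k) = Set.Ici 0 := by
  ext p
  simp only [Set.mem_iUnion, Set.mem_Ici]
  constructor
  · rintro ⟨n, hn⟩
    exact le_trans (by positivity) hn.1
  · intro hp
    refine ⟨⌊p / k⌋₊, ?_, ?_⟩
    · rw [← le_div_iff₀ hk]
      exact Nat.floor_le (by positivity)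
    · rw [← div_lt_iff₀ hk]
      exact Nat.lt_floor_add_one _

lemma pairwise_disjoint_Ico_natCast_mul {k : ℝ} (hk : 0 < k) :
    Pairwise (Function.onFun Disjoint fun n : ℕ => Set.Ico (n * k) ((n + 1) * k)) := by
  intro m n hmn
  refine Set.disjoint_left.mpr fun p hm hn => hmn ?_
  rw [← floor_div_eq_of_mem_Ico hk hm, floor_div_eq_of_mem_Ico hk hn]

lemma setIntegral_Ico_exp_neg_mul {t k : ℝ} (ht : 0 < t) (hk : 0 < k) (n : ℕ) :
    ∫ p in Set.Ico (n * k) ((n + 1) * k), Real.exp (-(t * p))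
      = (1 - Real.exp (-(k * t))) / t * Real.exp (-(k * t)) ^ n := by
  have hle : (n : ℝ) * k ≤ (n + 1) * k := by nlinarith
  have hderiv : ∀ x ∈ Set.uIcc ((n : ℝ) * k) ((n + 1) * k),
      HasDerivAt (fun p => -Real.exp (-(t * p)) / t) (Real.exp (-(t * x))) x := by
    intro x _
    refine ((((hasDerivAt_id x).const_mul t).neg.exp).neg.div_const t).congr_deriv ?_
    change -(Real.exp (-(t * x)) * -(t * 1)) / t = Real.exp (-(t * x))
    field_simp
  rw [integral_Ico_eq_integral_Ioc, ← intervalIntegral.integral_of_le hle,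
    intervalIntegral.integral_eq_sub_of_hasDerivAt hderiv
      (Continuous.intervalIntegrable (by fun_prop) _ _),
    ← Real.exp_nat_mul,
    show -(t * ((n + 1) * k)) = n * -(k * t) + -(k * t) by ring,
    show -(t * (n * k)) = n * -(k * t) by ring, Real.exp_add]
  ring

/-- The Laplace transform of a step function with steps of length `k`. -/
lemma integrableOn_and_hasSum_step_mul_exp {t k : ℝ} (ht : 0 < t) (hk : 0 < k) (c : ℕ → ℝ)
    (hc : Summable fun n => ‖c n‖ * Real.exp (-(k * t)) ^ n) :
    IntegrableOn (fun p : ℝ => c ⌊p / k⌋₊ * Real.exp (-(t * p))) (Set.Ici 0) ∧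
    HasSum (fun n => (1 - Real.exp (-(k * t))) / t * (c n * Real.exp (-(k * t)) ^ n))
      (∫ p in Set.Ici (0 : ℝ), c ⌊p / k⌋₊ * Real.exp (-(t * p))) := by
  have hpiece (n : ℕ) : Set.EqOn (fun p : ℝ => c ⌊p / k⌋₊ * Real.exp (-(t * p)))
      (fun p => c n * Real.exp (-(t * p))) (Set.Ico (n * k) ((n + 1) * k)) := by
    intro p hp
    simp only [floor_div_eq_of_mem_Ico hk hp]
  have hint : IntegrableOn (fun p : ℝ => c ⌊p / k⌋₊ * Real.exp (-(t * p)))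
      (⋃ n : ℕ, Set.Ico (n * k) ((n + 1) * k)) := by
    refine integrableOn_iUnion_of_summable_integral_norm (fun n => ?_) ?_
    · refine IntegrableOn.congr_fun ?_ (hpiece n).symm measurableSet_Ico
      exact (Continuous.integrableOn_Icc (by fun_prop)).mono_set Set.Ico_subset_Icc_self
    · refine (hc.mul_left ((1 - Real.exp (-(k * t))) / t)).congr fun n => ?_
      rw [setIntegral_congr_fun (g := fun p => ‖c n‖ * Real.exp (-(t * p))) measurableSet_Ico,
        integral_const_mul, setIntegral_Ico_exp_neg_mul ht hk]
      · ring
      · intro p hp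
        simp only [floor_div_eq_of_mem_Ico hk hp, norm_mul, Real.norm_eq_abs, Real.abs_exp]
  have hsum := hasSum_integral_iUnion (fun _ => measurableSet_Ico)
    (pairwise_disjoint_Ico_natCast_mul hk) hint
  rw [iUnion_Ico_natCast_mul hk] at hint hsum
  refine ⟨hint, hsum.congr_fun fun n => ?_⟩
  rw [setIntegral_congr_fun measurableSet_Ico (hpiece n), integral_const_mul,
    setIntegral_Ico_exp_neg_mul ht hk]
  ring

/-- The Laplace-transform identity
`∫₀^∞ ((a^⌊p/k⌋ − 1)/(a − 1))·e^{−tp} dp = 1/(t(e^{kt} − a))`,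
together with the integrability of the integrand. -/
theorem statement12 (t k a : ℝ) (ht : 0 < t) (hk : 0 < k)
    (ha1 : a ≠ 1) (ha : |a| < Real.exp (k * t)) :
    IntegrableOn
      (fun p : ℝ => ((a ^ ⌊p / k⌋₊ - 1) / (a - 1)) * Real.exp (-(t * p)))
      (Set.Ici 0) ∧
    ∫ p in Set.Ici (0 : ℝ), ((a ^ ⌊p / k⌋₊ - 1) / (a - 1)) * Real.exp (-(t * p))
      = 1 / (t * (Real.exp (k * t) - a)) := by
  have hr0 : 0 < Real.exp (-(k * t)) := Real.exp_pos _
  have hr1 : Real.exp (-(k * t)) < 1 := Real.exp_lt_one_iff.mpr (neg_neg_of_pos (mul_pos hk ht))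
  have hE : Real.exp (k * t) = (Real.exp (-(k * t)))⁻¹ := by rw [Real.exp_neg, inv_inv]
  have har : |a * Real.exp (-(k * t))| < 1 := by
    rw [abs_mul, Real.abs_exp]
    rwa [hE, ← one_div, lt_div_iff₀ hr0] at ha
  have hgeom : HasSum (fun n => (a ^ n - 1) / (a - 1) * Real.exp (-(k * t)) ^ n)
      (((1 - a * Real.exp (-(k * t)))⁻¹ - (1 - Real.exp (-(k * t)))⁻¹) / (a - 1)) := by
    refine (((hasSum_geometric_of_abs_lt_one har).sub
      (hasSum_geometric_of_lt_one hr0.le hr1)).div_const (a - 1)).congr_fun fun n => ?_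
    rw [mul_pow]
    ring
  obtain ⟨hint, hsum⟩ := integrableOn_and_hasSum_step_mul_exp ht hk
    (fun n => (a ^ n - 1) / (a - 1))
    (hgeom.summable.norm.congr fun n => by
      rw [norm_mul, norm_pow, Real.norm_eq_abs (Real.exp _), Real.abs_exp])
  refine ⟨hint, ?_⟩
  rw [hsum.unique (hgeom.mul_left _), hE]
  have h1 : 1 - a * Real.exp (-(k * t)) ≠ 0 :=
    (sub_pos.mpr (abs_lt.mp har).2).ne'
  have h2 : 1 - Real.exp (-(k * t)) ≠ 0 := (sub_pos.mpr hr1).ne'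
  have h3 : a - 1 ≠ 0 := sub_ne_zero.mpr ha1
  generalize Real.exp (-(k * t)) = r at *
  rw [show r⁻¹ - a = (1 - a * r) / r by field_simp, inv_sub_inv h1 h2]
  field_simp
  ring
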